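/- Fix an integer d ≥ 3. Let κ : [−1,1] → ℝ be C^∞ on (−1,1), let r ≥ 1 be an integer, let ν₁ < ν₂ < ⋯ < ν_r be non-integer positive reals, let c_{j,1}, c_{j,−1} ∈ ℝ for j = 1,…,r, and let ε > 0 satisfy ε < ν₂ − ν₁ when r ≥ 2. Assume that for every integer s ≥ 0 there exist real polynomials p_{s,1}, p_{s,−1} such that, as t → 0⁺, κ^{(s)}(1−t) = p_{s,1}(t) + (−1)^s Σ_{j=1}^r c_{j,1} (Γ(ν_j+1)/Γ(ν_j+1−s)) t^{ν_j−s} + O(t^{ν₁+1+ε−s}) and κ^{(s)}(−1+t) = p_{s,−1}(t) + Σ_{j=1}^r c_{j,−1} (Γ(ν_j+1)/Γ(ν_j+1−s)) t^{ν_j−s} + O(t^{ν₁+1+ε−s}). Then: (i) if c_{1,1} = −c_{1,−1}, then μ_k(κ) = o(k^{−d−2ν₁+1}) as k → ∞ along even k; (ii) if c_{1,1} = c_{1,−1}, then μ_k(κ) = o(k^{−d−2ν₁+1}) as k → ∞ along odd k. -/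

import Mathlib

open Filter Asymptotics Real Set Topology

/-- Legendre polynomial of degree `k` in dimension `d` (Rodrigues formula). -/
noncomputable def legendreP (d k : ℕ) (t : ℝ) : ℝ :=
  (-1 / 2 : ℝ) ^ k * (Real.Gamma (((d : ℝ) - 1) / 2) / Real.Gamma ((k : ℝ) + ((d : ℝ) - 1) / 2)) *
    (1 - t ^ 2) ^ ((3 - (d : ℝ)) / 2) *
    iteratedDeriv k (fun s : ℝ => (1 - s ^ 2) ^ ((k : ℝ) + ((d : ℝ) - 3) / 2)) t

/-- Surface area `ω_{p-1}` of the unit sphere in `ℝ^p`. -/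
noncomputable def sphereSurface (p : ℕ) : ℝ :=
  2 * Real.pi ^ ((p : ℝ) / 2) / Real.Gamma ((p : ℝ) / 2)

/-- `μ_k(κ)`, the `k`-th Legendre coefficient of `κ` in dimension `d`. -/
noncomputable def legendreCoeff (d k : ℕ) (κ : ℝ → ℝ) : ℝ :=
  (sphereSurface (d - 1) / sphereSurface d) *
    ∫ t in (-1 : ℝ)..1, κ t * legendreP d k t * (1 - t ^ 2) ^ (((d : ℝ) - 3) / 2)

open MeasureTheory

/-- Polynomials with `D^n (1-t^2)^a = (1-t^2)^(a-n) q_n`. -/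
noncomputable def qp (a : ℝ) : ℕ → Polynomial ℝ
  | 0 => 1
  | n + 1 => (1 - Polynomial.X ^ 2) * Polynomial.derivative (qp a n)
      - Polynomial.C (2 * (a - n)) * Polynomial.X * qp a n

lemma qp_deriv (a : ℝ) (n : ℕ) : Polynomial.derivative (qp a (n + 1)) =
    Polynomial.C (-((n + 1) * (2 * a - n))) * qp a n := by
  induction n with
  | zero => simp [qp]
  | succ n ih =>
    have h1 : qp a (n + 2) = (1 - Polynomial.X ^ 2) * Polynomial.derivative (qp a (n + 1))
      - Polynomial.C (2 * (a - (n + 1 : ℕ))) * Polynomial.X * qp a (n + 1) := rfl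
    have h2 : qp a (n + 1) = (1 - Polynomial.X ^ 2) * Polynomial.derivative (qp a n)
      - Polynomial.C (2 * (a - n)) * Polynomial.X * qp a n := rfl
    have h3 : (1 - Polynomial.X ^ 2) * Polynomial.derivative (qp a n)
      = qp a (n + 1) + Polynomial.C (2 * (a - n)) * Polynomial.X * qp a n := by
      rw [h2]; ring
    rw [show n + 1 + 1 = n + 2 from rfl, h1, ih]
    simp only [Polynomial.derivative_sub, Polynomial.derivative_mul, Polynomial.derivative_C,
      Polynomial.derivative_X, Polynomial.derivative_pow, ih, Polynomial.derivative_one]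
    have h4 : (1 - Polynomial.X ^ 2) * (0 * qp a n +
      Polynomial.C (-((n + 1) * (2 * a - n))) * Polynomial.derivative (qp a n))
      = Polynomial.C (-((n + 1) * (2 * a - n))) *
        (qp a (n + 1) + Polynomial.C (2 * (a - n)) * Polynomial.X * qp a n) := by
      rw [← h3]; ring
    rw [h4]
    simp only [Polynomial.C_mul, Polynomial.C_neg, Polynomial.C_add, Polynomial.C_sub,
      Polynomial.C_1, Nat.cast_add, Nat.cast_one]
    have hC2 : (Polynomial.C 2 : Polynomial ℝ) = 2 := rfl
    simp [hC2]
    ring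

lemma w_pos {t : ℝ} (ht : t ∈ Ioo (-1 : ℝ) 1) : 0 < 1 - t ^ 2 := by
  nlinarith [ht.1, ht.2]

lemma w_le {t : ℝ} : 1 - t ^ 2 ≤ 1 := by nlinarith [sq_nonneg t]

lemma hasDerivAt_qw (a : ℝ) (n : ℕ) {t : ℝ} (ht : t ∈ Ioo (-1 : ℝ) 1) :
    HasDerivAt (fun s : ℝ => (1 - s ^ 2) ^ (a - n) * (qp a n).eval s)
      ((1 - t ^ 2) ^ (a - (n + 1 : ℕ)) * (qp a (n + 1)).eval t) t := by
  have hw := w_pos ht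
  have h1 : HasDerivAt (fun s : ℝ => 1 - s ^ 2) (-(2 * t)) t := by
    simpa using ((hasDerivAt_id t).pow 2).const_sub 1
  have h2 := h1.rpow_const (p := a - n) (Or.inl hw.ne')
  have h3 := (qp a n).hasDerivAt t
  refine (h2.mul h3).congr_deriv ?_
  have e : (1 - t ^ 2) ^ (a - n) = (1 - t ^ 2) ^ (a - (n + 1 : ℕ)) * (1 - t ^ 2) := by
    rw [← Real.rpow_add_one hw.ne']; congr 1; push_cast; ring
  have e2 : a - n - 1 = a - (n + 1 : ℕ) := by push_cast; ring
  rw [e2, e]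
  simp [qp]
  ring

lemma iteratedDeriv_w (a : ℝ) (n : ℕ) : ∀ t ∈ Ioo (-1 : ℝ) 1,
    iteratedDeriv n (fun s : ℝ => (1 - s ^ 2) ^ a) t = (1 - t ^ 2) ^ (a - n) * (qp a n).eval t := by
  induction n with
  | zero => intro t ht; simp [qp]
  | succ n ih =>
    intro t ht
    rw [iteratedDeriv_succ]
    have : iteratedDeriv n (fun s : ℝ => (1 - s ^ 2) ^ a) =ᶠ[𝓝 t]
        fun s : ℝ => (1 - s ^ 2) ^ (a - n) * (qp a n).eval s := by
      filter_upwards [isOpen_Ioo.mem_nhds ht] with s hs using ih s hs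
    rw [this.deriv_eq, (hasDerivAt_qw a n ht).deriv]

/-- The Rodrigues normalising factor. -/
noncomputable def rodA (σ : ℝ) (k : ℕ) : ℝ :=
  (-1 / 2 : ℝ) ^ k * (Real.Gamma (σ + 1) / Real.Gamma ((k : ℝ) + σ + 1))

lemma legendreCoeff_eq (d k : ℕ) (κ : ℝ → ℝ) : ∀ σ : ℝ, σ = ((d : ℝ) - 3) / 2 →
    legendreCoeff d k κ = (sphereSurface (d - 1) / sphereSurface d) * (rodA σ k *
      ∫ t in Ioo (-1 : ℝ) 1, κ t * (qp (k + σ) k).eval t * (1 - t ^ 2) ^ σ) := by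
  intro σ hσ
  unfold legendreCoeff
  congr 1
  rw [intervalIntegral.integral_of_le (by norm_num), integral_Ioc_eq_integral_Ioo,
    ← integral_const_mul]
  refine setIntegral_congr_fun measurableSet_Ioo fun t ht => ?_
  have hw := w_pos ht
  simp only [legendreP, rodA, ← hσ]
  rw [iteratedDeriv_w _ _ t ht, show (3 - (d : ℝ)) / 2 = -σ by rw [hσ]; ring,
    show ((d : ℝ) - 1) / 2 = σ + 1 by rw [hσ]; ring, Real.rpow_neg hw.le,
    show (k : ℝ) + σ - k = σ by ring, add_assoc]
  have := (Real.rpow_pos_of_pos hw σ).ne'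
  field_simp

lemma integrable_aux {f : ℝ → ℝ} (hf : ContinuousOn f (Ioo (-1 : ℝ) 1)) {C : ℝ}
    (hC : ∀ t ∈ Ioo (-1 : ℝ) 1, |f t| ≤ C) : IntegrableOn f (Ioo (-1 : ℝ) 1) := by
  refine Integrable.of_bound (C := C) ?_ ?_
  · exact hf.aestronglyMeasurable measurableSet_Ioo
  · exact (ae_restrict_iff' measurableSet_Ioo).2 (Eventually.of_forall hC)

lemma poly_bdd (p : Polynomial ℝ) : ∃ C, 0 ≤ C ∧ ∀ t ∈ Ioo (-1 : ℝ) 1, |p.eval t| ≤ C := by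
  obtain ⟨C, hC⟩ := (isCompact_Icc (a := (-1 : ℝ)) (b := 1)).exists_bound_of_continuousOn
    (f := fun t => p.eval t) p.continuous.continuousOn
  refine ⟨|C|, abs_nonneg _, fun t ht => (hC t (Ioo_subset_Icc_self ht)).trans (le_abs_self _)⟩

lemma cont_w (b : ℝ) : ContinuousOn (fun t : ℝ => (1 - t ^ 2) ^ b) (Ioo (-1 : ℝ) 1) := by
  intro t ht
  have h : ContinuousAt (fun t : ℝ => 1 - t ^ 2) t := by fun_prop
  exact (h.rpow_const (Or.inl (w_pos ht).ne')).continuousWithinAt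

lemma bound_aux {f : ℝ → ℝ} {s : ℕ} {C : ℝ} (hC : ∀ t ∈ Ioo (-1 : ℝ) 1, |f t| * (1 - t ^ 2) ^ s ≤ C)
    (p : Polynomial ℝ) {b : ℝ} (hb : 0 ≤ b) :
    ∃ K, ∀ t ∈ Ioo (-1 : ℝ) 1, |f t * p.eval t * (1 - t ^ 2) ^ (b + s)| ≤ K := by
  obtain ⟨D, hD0, hD⟩ := poly_bdd p
  refine ⟨C * D, fun t ht => ?_⟩
  have hw := w_pos ht
  have h1 := hC t ht
  have h2 := hD t ht
  have h3 : (1 - t ^ 2) ^ b ≤ 1 := Real.rpow_le_one hw.le w_le hb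
  have h4 := Real.rpow_nonneg hw.le b
  rw [Real.rpow_add_natCast hw.ne', abs_mul, abs_mul, abs_mul, abs_of_nonneg h4,
    abs_of_nonneg (pow_nonneg hw.le s)]
  have h5 : 0 ≤ |f t| * (1 - t ^ 2) ^ s := by positivity
  calc _ = (|f t| * (1 - t ^ 2) ^ s) * |p.eval t| * (1 - t ^ 2) ^ b := by ring
    _ ≤ (|f t| * (1 - t ^ 2) ^ s) * |p.eval t| * 1 := by gcongr
    _ ≤ C * D := by rw [mul_one]; gcongr; exact h5.trans h1

lemma integrable_fq {f : ℝ → ℝ} (hf : ContinuousOn f (Ioo (-1 : ℝ) 1)) {s : ℕ} {C : ℝ}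
    (hC : ∀ t ∈ Ioo (-1 : ℝ) 1, |f t| * (1 - t ^ 2) ^ s ≤ C)
    (p : Polynomial ℝ) {b : ℝ} (hb : 0 ≤ b) :
    IntegrableOn (fun t => f t * p.eval t * (1 - t ^ 2) ^ (b + s)) (Ioo (-1 : ℝ) 1) := by
  obtain ⟨K, hK⟩ := bound_aux hC p hb
  exact integrable_aux ((hf.mul p.continuous.continuousOn).mul (cont_w _)) hK

lemma ibp1 {f f' : ℝ → ℝ} (hf : ∀ t ∈ Ioo (-1 : ℝ) 1, HasDerivAt f (f' t) t)
    (hf' : ContinuousOn f' (Ioo (-1 : ℝ) 1)) {s : ℕ} {C C' : ℝ}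
    (hC : ∀ t ∈ Ioo (-1 : ℝ) 1, |f t| * (1 - t ^ 2) ^ s ≤ C)
    (hC' : ∀ t ∈ Ioo (-1 : ℝ) 1, |f' t| * (1 - t ^ 2) ^ (s + 1) ≤ C')
    {a b : ℝ} {n : ℕ} (hb : 0 ≤ b) (hab : a - (n + 1 : ℕ) = b + s) :
    ∫ t in Ioo (-1 : ℝ) 1, f t * (qp a (n + 1)).eval t * (1 - t ^ 2) ^ (b + s) =
    -∫ t in Ioo (-1 : ℝ) 1, f' t * (qp a n).eval t * (1 - t ^ 2) ^ (b + (s + 1 : ℕ)) := by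
  have hab' : a - n = b + (s + 1 : ℕ) := by push_cast at hab ⊢; linarith
  have hfc : ContinuousOn f (Ioo (-1 : ℝ) 1) := fun t ht => (hf t ht).continuousAt.continuousWithinAt
  have i1 := integrable_fq hfc hC (qp a (n + 1)) hb
  have i2 := integrable_fq hf' hC' (qp a n) hb
  set G : ℝ → ℝ := fun t => f t * ((1 - t ^ 2) ^ (a - n) * (qp a n).eval t) with hG
  have hGd : ∀ t ∈ Ioo (-1 : ℝ) 1, HasDerivAt G (f t * (qp a (n + 1)).eval t * (1 - t ^ 2) ^ (b + s)
      + f' t * (qp a n).eval t * (1 - t ^ 2) ^ (b + (s + 1 : ℕ))) t := by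
    intro t ht
    refine ((hf t ht).mul (hasDerivAt_qw a n ht)).congr_deriv ?_
    rw [hab, hab']; ring
  obtain ⟨K, hK⟩ := bound_aux hC (qp a n) hb
  have hGb : ∀ t ∈ Ioo (-1 : ℝ) 1, ‖G t‖ ≤ K * (1 - t ^ 2) := by
    intro t ht
    have hw := w_pos ht
    have : G t = (f t * (qp a n).eval t * (1 - t ^ 2) ^ (b + s)) * (1 - t ^ 2) := by
      simp only [hG]
      rw [hab', Nat.cast_add, Nat.cast_one, ← add_assoc, Real.rpow_add_one hw.ne']; ring
    rw [this, norm_mul, Real.norm_eq_abs, Real.norm_of_nonneg hw.le]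
    gcongr
    exact hK t ht
  have hc : Continuous fun t : ℝ => K * (1 - t ^ 2) := by fun_prop
  have l1 : Tendsto G (𝓝[>] (-1 : ℝ)) (𝓝 0) := by
    refine squeeze_zero_norm' (a := fun t : ℝ => K * (1 - t ^ 2)) ?_ ?_
    · filter_upwards [Ioo_mem_nhdsGT (show (-1 : ℝ) < 1 by norm_num)] with t ht using hGb t ht
    · have := (hc.tendsto (-1)).mono_left (nhdsWithin_le_nhds (s := Ioi (-1)))
      simpa using this
  have l2 : Tendsto G (𝓝[<] (1 : ℝ)) (𝓝 0) := by
    refine squeeze_zero_norm' (a := fun t : ℝ => K * (1 - t ^ 2)) ?_ ?_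
    · filter_upwards [Ioo_mem_nhdsLT (show (-1 : ℝ) < 1 by norm_num)] with t ht using hGb t ht
    · have := (hc.tendsto (1)).mono_left (nhdsWithin_le_nhds (s := Iio 1))
      simpa using this
  have hInt := i1.add i2
  have key := intervalIntegral.integral_eq_sub_of_hasDerivAt_of_tendsto (by norm_num) hGd
    ((intervalIntegrable_iff_integrableOn_Ioo_of_le (by norm_num)).2 hInt) l1 l2
  rw [intervalIntegral.integral_of_le (by norm_num), integral_Ioc_eq_integral_Ioo,
    integral_add i1 i2] at key
  linarith

lemma ibp {F : ℕ → ℝ → ℝ} (hF : ∀ s, ∀ t ∈ Ioo (-1 : ℝ) 1, HasDerivAt (F s) (F (s + 1) t) t)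
    (hC : ∀ s, ∃ C, ∀ t ∈ Ioo (-1 : ℝ) 1, |F s t| * (1 - t ^ 2) ^ s ≤ C)
    {σ : ℝ} (hσ : 0 ≤ σ) {k : ℕ} (m : ℕ) (hm : m ≤ k) :
    ∫ t in Ioo (-1 : ℝ) 1, F 0 t * (qp (k + σ) k).eval t * (1 - t ^ 2) ^ σ =
    (-1) ^ m *
      ∫ t in Ioo (-1 : ℝ) 1, F m t * (qp (k + σ) (k - m)).eval t * (1 - t ^ 2) ^ (σ + m) := by
  induction m with
  | zero => simp
  | succ m ih =>
    rw [ih (by omega)]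
    obtain ⟨C, h1⟩ := hC m
    obtain ⟨C', h2⟩ := hC (m + 1)
    obtain ⟨n, hn⟩ : ∃ n, k = n + 1 + m := ⟨k - 1 - m, by omega⟩
    have e1 : k - m = n + 1 := by omega
    have e2 : k - (m + 1) = n := by omega
    rw [e1, e2, ibp1 (hF m) (fun t ht => (hF (m + 1) t ht).continuousAt.continuousWithinAt)
      h1 h2 hσ (by rw [hn]; push_cast; ring)]
    ring

lemma M_rec {k : ℕ} {σ : ℝ} (hσ : 0 ≤ σ) (n : ℕ) (hn : n ≤ k) :
    ∫ t in Ioo (-1 : ℝ) 1, ((qp (k + σ) n).eval t) ^ 2 * (1 - t ^ 2) ^ (k + σ - n) =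
    (∏ i ∈ Finset.range n, ((i + 1) * (2 * (k + σ) - i))) *
      ∫ t in Ioo (-1 : ℝ) 1, (1 - t ^ 2) ^ (k + σ) := by
  induction n with
  | zero => simp [qp]
  | succ n ih =>
    obtain ⟨C, -, h1⟩ := poly_bdd (qp (k + σ) (n + 1))
    obtain ⟨C', -, h2⟩ := poly_bdd (Polynomial.derivative (qp (k + σ) (n + 1)))
    have hn' : ((n + 1 : ℕ) : ℝ) ≤ k := by exact_mod_cast hn
    have := ibp1 (f := fun t => (qp (k + σ) (n + 1)).eval t)
      (f' := fun t => (Polynomial.derivative (qp (k + σ) (n + 1))).eval t) (s := 0) (C := C) (C' := C')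
      (a := k + σ) (b := k + σ - (n + 1 : ℕ)) (n := n)
      (fun t ht => Polynomial.hasDerivAt _ _) (Polynomial.continuous _).continuousOn
      (fun t ht => by simpa using h1 t ht)
      (fun t ht => by
        have := h2 t ht
        have hw := w_pos ht
        have hw' := w_le (t := t)
        simp only [zero_add, pow_one]
        calc _ ≤ |(Polynomial.derivative (qp (k + σ) (n + 1))).eval t| * 1 := by gcongr
          _ ≤ C' := by rw [mul_one]; exact this) (by linarith) (by simp)
    rw [Finset.prod_range_succ]
    have e : ∀ I X c : ℝ, X = I * c → c * I = X := by intros; subst_vars; ring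
    calc _ = ∫ t in Ioo (-1 : ℝ) 1, (qp (k + σ) (n + 1)).eval t * (qp (k + σ) (n + 1)).eval t *
          (1 - t ^ 2) ^ (k + σ - (n + 1 : ℕ) + (0 : ℕ)) := by
            congr 1; ext t; rw [Nat.cast_zero, add_zero]; ring
      _ = _ := this
      _ = ∫ t in Ioo (-1 : ℝ) 1, ((n + 1) * (2 * (k + σ) - n)) *
          (((qp (k + σ) n).eval t) ^ 2 * (1 - t ^ 2) ^ (k + σ - n)) := by
            rw [← integral_neg]; congr 1; ext t
            rw [qp_deriv, show (k : ℝ) + σ - (n + 1 : ℕ) + (0 + 1 : ℕ) = k + σ - n by push_cast; ring]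
            simp; ring
      _ = _ := by rw [integral_const_mul, ih (by omega)]; ring

lemma beta_real {α β : ℝ} (hα : 0 < α) (hβ : 0 < β) :
    ∫ x in (0 : ℝ)..1, x ^ (α - 1) * (1 - x) ^ (β - 1) =
      Real.Gamma α * Real.Gamma β / Real.Gamma (α + β) := by
  have h := ProbabilityTheory.beta_eq_betaIntegralReal α β hα hβ
  have h2 : Complex.betaIntegral α β =
      ((∫ x in (0 : ℝ)..1, x ^ (α - 1) * (1 - x) ^ (β - 1) : ℝ) : ℂ) := by
    rw [Complex.betaIntegral, ← intervalIntegral.integral_ofReal]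
    refine intervalIntegral.integral_congr fun x hx => ?_
    rw [uIcc_of_le zero_le_one] at hx
    push_cast
    rw [Complex.ofReal_cpow hx.1, Complex.ofReal_cpow (by linarith [hx.2])]
    push_cast
    rfl
  rw [h2, Complex.ofReal_re, ProbabilityTheory.beta] at h
  exact h.symm

lemma beta_int {α β : ℝ} (hα : 0 < α) (hβ : 0 < β) :
    ∫ t in Ioo (-1 : ℝ) 1, (1 - t) ^ (α - 1) * (1 + t) ^ (β - 1) =
      2 ^ (α + β - 1) * (Real.Gamma α * Real.Gamma β / Real.Gamma (α + β)) := by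
  have h := intervalIntegral.integral_comp_sub_mul (a := -1) (b := 1)
    (fun x : ℝ => x ^ (α - 1) * (1 - x) ^ (β - 1)) (c := 1 / 2) (by norm_num) (1 / 2)
  norm_num at h
  rw [beta_real hα hβ] at h
  have e : ∫ t in Ioo (-1 : ℝ) 1, (1 - t) ^ (α - 1) * (1 + t) ^ (β - 1) =
    2 ^ (α + β - 2) * ∫ x in (-1 : ℝ)..1, (1 / 2 - 1 / 2 * x) ^ (α - 1) *
      (1 - (1 / 2 - 1 / 2 * x)) ^ (β - 1) := by
    rw [intervalIntegral.integral_of_le (by norm_num), integral_Ioc_eq_integral_Ioo,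
      ← integral_const_mul]
    refine setIntegral_congr_fun measurableSet_Ioo fun t ht => ?_
    have h1 : 0 < 1 - t := by linarith [ht.2]
    have h2 : 0 < 1 + t := by linarith [ht.1]
    rw [show (1 : ℝ) / 2 - 1 / 2 * t = (1 - t) / 2 by ring,
      show 1 - (1 - t) / 2 = (1 + t) / 2 by ring, Real.div_rpow h1.le (by norm_num),
      Real.div_rpow h2.le (by norm_num), show α + β - 2 = (α - 1) + (β - 1) by ring,
      Real.rpow_add (by norm_num)]
    have := (Real.rpow_pos_of_pos (show (0 : ℝ) < 2 by norm_num) (α - 1)).ne'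
    have := (Real.rpow_pos_of_pos (show (0 : ℝ) < 2 by norm_num) (β - 1)).ne'
    field_simp
  rw [e, h, show α + β - 1 = (α + β - 2) + 1 by ring, Real.rpow_add_one (by norm_num)]
  ring

lemma w_rpow {t : ℝ} (ht : t ∈ Ioo (-1 : ℝ) 1) (b : ℝ) :
    (1 - t ^ 2) ^ b = (1 - t) ^ b * (1 + t) ^ b := by
  rw [← Real.mul_rpow (by linarith [ht.2]) (by linarith [ht.1])]
  congr 1; ring

lemma w_int {b : ℝ} (hb : -1 < b) : ∫ t in Ioo (-1 : ℝ) 1, (1 - t ^ 2) ^ b =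
    2 ^ (2 * b + 1) * (Real.Gamma (b + 1) * Real.Gamma (b + 1) / Real.Gamma (2 * b + 2)) := by
  have := beta_int (α := b + 1) (β := b + 1) (by linarith) (by linarith)
  rw [show b + 1 + (b + 1) - 1 = 2 * b + 1 by ring, show b + 1 + (b + 1) = 2 * b + 2 by ring] at this
  rw [← this]
  refine setIntegral_congr_fun measurableSet_Ioo fun t ht => ?_
  simp only [add_sub_cancel_right]
  exact w_rpow ht b

lemma w_integrable {b : ℝ} (hb : -1 < b) :
    IntegrableOn (fun t : ℝ => (1 - t ^ 2) ^ b) (Ioo (-1 : ℝ) 1) := by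
  by_contra h
  have h1 := integral_undef h
  rw [w_int hb] at h1
  have g1 := Real.Gamma_pos_of_pos (show 0 < b + 1 by linarith)
  have g2 := Real.Gamma_pos_of_pos (show 0 < 2 * b + 2 by linarith)
  have : 0 < (2 : ℝ) ^ (2 * b + 1) *
    (Real.Gamma (b + 1) * Real.Gamma (b + 1) / Real.Gamma (2 * b + 2)) := by positivity
  linarith

lemma prod_bound (d m N : ℕ) (hd : 3 ≤ d) :
    (∏ i ∈ Finset.range N, (((i : ℝ) + 1) * (((2 * (N + m) + d - 3 : ℕ) : ℝ) - i))) /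
      ((2 * (N + m) + d - 3 + 1).factorial : ℝ) ≤ 1 / ((N : ℝ) + 1) ^ (2 * m + d - 2) := by
  set T := 2 * (N + m) + d - 3 with hT
  have e1 : ∏ i ∈ Finset.range N, (((i : ℝ) + 1) * ((T : ℝ) - i)) =
      (N.factorial : ℝ) * (T.descFactorial N : ℝ) := by
    rw [Finset.prod_mul_distrib, ← Finset.prod_range_add_one_eq_factorial,
      Nat.descFactorial_eq_prod_range]
    push_cast
    congr 1
    refine Finset.prod_congr rfl fun i hi => ?_
    have := Finset.mem_range.1 hi
    have h : i ≤ T := by omega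
    rw [Nat.cast_sub h]
  have e2 : ((T - N).factorial : ℝ) * (T.descFactorial N : ℝ) = T.factorial := by
    exact_mod_cast Nat.factorial_mul_descFactorial (by omega)
  have e3 : (N.factorial : ℝ) * ((N : ℝ) + 1) ^ (2 * m + d - 3) ≤ (T - N).factorial := by
    have := @Nat.factorial_mul_pow_le_factorial N (2 * m + d - 3)
    rw [show T - N = N + (2 * m + d - 3) by omega]
    exact_mod_cast this
  have e4 : ((T + 1).factorial : ℝ) = (T + 1) * T.factorial := by
    rw [Nat.factorial_succ]; push_cast; ring
  have hN : ((N : ℝ) + 1) ≤ T + 1 := by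
    have : N ≤ T := by omega
    have : (N : ℝ) ≤ T := by exact_mod_cast this
    linarith
  have p1 : (0 : ℝ) < (T - N).factorial := by positivity
  have p2 : (0 : ℝ) < (N.factorial : ℝ) := by positivity
  have p3 : (0 : ℝ) < (T.descFactorial N : ℝ) := by
    have : 0 < T.descFactorial N := Nat.descFactorial_pos.2 (by omega)
    exact_mod_cast this
  rw [e1, e4, ← e2, show 2 * m + d - 2 = (2 * m + d - 3) + 1 by omega, pow_succ]
  rw [div_le_div_iff₀ (by positivity) (by positivity)]
  calc (N.factorial : ℝ) * (T.descFactorial N) * (((N : ℝ) + 1) ^ (2 * m + d - 3) * (N + 1))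
      = (N.factorial * ((N : ℝ) + 1) ^ (2 * m + d - 3)) * T.descFactorial N * (N + 1) := by ring
    _ ≤ ((T - N).factorial : ℝ) * T.descFactorial N * (T + 1) := by gcongr
    _ = _ := by ring

lemma M_bound (d m N : ℕ) (hd : 3 ≤ d) {σ : ℝ} (hσ : σ = ((d : ℝ) - 3) / 2) :
    rodA σ (N + m) ^ 2 * ∫ t in Ioo (-1 : ℝ) 1,
      ((qp ((N + m : ℕ) + σ) N).eval t) ^ 2 * (1 - t ^ 2) ^ (σ + m) ≤
    (Real.Gamma (σ + 1) ^ 2 * 2 ^ (2 * σ + 1)) * (1 / ((N : ℝ) + 1) ^ (2 * m + d - 2)) := by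
  have hd' : (3 : ℝ) ≤ d := by exact_mod_cast hd
  have hσ0 : 0 ≤ σ := by rw [hσ]; linarith
  have h := M_rec (k := N + m) hσ0 N (by omega)
  rw [show ((N + m : ℕ) : ℝ) + σ - N = σ + m by push_cast; ring] at h
  have hk : (0 : ℝ) ≤ ((N + m : ℕ) : ℝ) := by positivity
  rw [h, w_int (by linarith)]
  have hT : 2 * (((N + m : ℕ) : ℝ) + σ) = ((2 * (N + m) + d - 3 : ℕ) : ℝ) := by
    rw [Nat.cast_sub (by omega), hσ]; push_cast; ring
  have hG : Real.Gamma (2 * (((N + m : ℕ) : ℝ) + σ) + 2) = (2 * (N + m) + d - 3 + 1).factorial := by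
    rw [hT, ← Real.Gamma_nat_eq_factorial]; congr 1; push_cast; ring
  have hp := prod_bound d m N hd
  rw [hG, rodA]
  have g0 := (Real.Gamma_pos_of_pos (show 0 < ((N + m : ℕ) : ℝ) + σ + 1 by linarith)).ne'
  have e2 : (2 : ℝ) ^ (2 * (((N + m : ℕ) : ℝ) + σ) + 1) = 2 ^ (2 * σ + 1) * 4 ^ (N + m) := by
    rw [show 2 * (((N + m : ℕ) : ℝ) + σ) + 1 = (2 * σ + 1) + (2 * (N + m) : ℕ) by push_cast; ring,
      Real.rpow_add_natCast (by norm_num), pow_mul]; norm_num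
  have e3 : ((-1 / 2 : ℝ) ^ (N + m)) ^ 2 * 4 ^ (N + m) = 1 := by
    rw [← pow_mul, mul_comm _ 2, pow_mul, ← mul_pow]; norm_num
  rw [e2, hT]
  calc _ = (((-1 / 2 : ℝ) ^ (N + m)) ^ 2 * 4 ^ (N + m)) * (Real.Gamma (σ + 1) ^ 2 * 2 ^ (2 * σ + 1)) *
      ((∏ i ∈ Finset.range N, (((i : ℝ) + 1) * (((2 * (N + m) + d - 3 : ℕ) : ℝ) - i))) /
      ((2 * (N + m) + d - 3 + 1).factorial : ℝ)) := by
        field_simp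
    _ ≤ _ := by rw [e3, one_mul]; gcongr

/-- falling product -/
noncomputable def fal (ν : ℝ) (s : ℕ) : ℝ := ∏ i ∈ Finset.range s, (ν - i)

/-- derivatives of `(1-t)^ν` -/
noncomputable def Fm (ν : ℝ) (s : ℕ) (t : ℝ) : ℝ := (-1) ^ s * (fal ν s * (1 - t) ^ (ν - s))

/-- derivatives of `(1+t)^ν` -/
noncomputable def Fp (ν : ℝ) (s : ℕ) (t : ℝ) : ℝ := fal ν s * (1 + t) ^ (ν - s)

lemma Fm_deriv (ν : ℝ) (s : ℕ) (t : ℝ) (ht : t ∈ Ioo (-1 : ℝ) 1) :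
    HasDerivAt (Fm ν s) (Fm ν (s + 1) t) t := by
  have h1 : HasDerivAt (fun t : ℝ => 1 - t) (-1) t := by
    simpa using (hasDerivAt_id t).const_sub 1
  have h2 := h1.rpow_const (p := ν - s) (Or.inl (by linarith [ht.2]))
  refine ((h2.const_mul (fal ν s)).const_mul ((-1) ^ s)).congr_deriv ?_
  simp only [Fm, fal, Finset.prod_range_succ]
  rw [show ν - (s + 1 : ℕ) = ν - s - 1 by push_cast; ring]
  ring

lemma Fp_deriv (ν : ℝ) (s : ℕ) (t : ℝ) (ht : t ∈ Ioo (-1 : ℝ) 1) :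
    HasDerivAt (Fp ν s) (Fp ν (s + 1) t) t := by
  have h1 : HasDerivAt (fun t : ℝ => 1 + t) 1 t := by
    simpa using (hasDerivAt_id t).const_add 1
  have h2 := h1.rpow_const (p := ν - s) (Or.inl (by linarith [ht.1]))
  refine (h2.const_mul (fal ν s)).congr_deriv ?_
  simp only [Fp, fal, Finset.prod_range_succ]
  rw [show ν - (s + 1 : ℕ) = ν - s - 1 by push_cast; ring]
  ring

lemma rpow_w_aux {ν : ℝ} (hν : 0 < ν) (s : ℕ) {x y : ℝ} (hx : 0 < x) (hy : 0 < y) (hx2 : x ≤ 2)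
    (hy2 : y ≤ 2) : x ^ (ν - s) * (x * y) ^ s ≤ 2 ^ ν * 2 ^ s := by
  have : x ^ (ν - s) * (x * y) ^ s = x ^ ν * y ^ s := by
    rw [mul_pow, ← mul_assoc, ← Real.rpow_add_natCast hx.ne']; congr 2; ring
  rw [this]
  gcongr

lemma Fm_bound {ν : ℝ} (hν : 0 < ν) (s : ℕ) :
    ∃ C, ∀ t ∈ Ioo (-1 : ℝ) 1, |Fm ν s t| * (1 - t ^ 2) ^ s ≤ C := by
  refine ⟨|fal ν s| * (2 ^ ν * 2 ^ s), fun t ht => ?_⟩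
  have h1 : 0 < 1 - t := by linarith [ht.2]
  have h2 : 0 < 1 + t := by linarith [ht.1]
  have := rpow_w_aux hν s h1 h2 (by linarith) (by linarith)
  rw [Fm, abs_mul, abs_mul, abs_of_pos (Real.rpow_pos_of_pos h1 _), abs_pow, abs_neg, abs_one,
    one_pow, one_mul, mul_assoc, show 1 - t ^ 2 = (1 - t) * (1 + t) by ring]
  gcongr

lemma Fp_bound {ν : ℝ} (hν : 0 < ν) (s : ℕ) :
    ∃ C, ∀ t ∈ Ioo (-1 : ℝ) 1, |Fp ν s t| * (1 - t ^ 2) ^ s ≤ C := by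
  refine ⟨|fal ν s| * (2 ^ ν * 2 ^ s), fun t ht => ?_⟩
  have h1 : 0 < 1 - t := by linarith [ht.2]
  have h2 : 0 < 1 + t := by linarith [ht.1]
  have := rpow_w_aux hν s h2 h1 (by linarith) (by linarith)
  rw [Fp, abs_mul, abs_of_pos (Real.rpow_pos_of_pos h2 _), mul_assoc,
    show 1 - t ^ 2 = (1 + t) * (1 - t) by ring]
  gcongr

/-- explicit value of the coefficient of `(1-t)^ν` -/
noncomputable def EE (ν σ : ℝ) (k : ℕ) : ℝ := fal ν k * (2 ^ (ν + k + 2 * σ + 1) *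
  (Real.Gamma (ν + σ + 1) * Real.Gamma (k + σ + 1) / Real.Gamma (ν + k + 2 * σ + 2)))

lemma int_Fm {ν σ : ℝ} (hν : 0 < ν) (hσ : 0 ≤ σ) (k : ℕ) :
    ∫ t in Ioo (-1 : ℝ) 1, Fm ν 0 t * (qp (k + σ) k).eval t * (1 - t ^ 2) ^ σ = EE ν σ k := by
  rw [ibp (Fm_deriv ν) (Fm_bound hν) hσ k le_rfl]
  have hk : (0 : ℝ) ≤ (k : ℝ) := by positivity
  have h := beta_int (α := ν + σ + 1) (β := k + σ + 1) (by linarith) (by linarith)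
  rw [show ν + σ + 1 + (k + σ + 1) - 1 = ν + k + 2 * σ + 1 by ring,
    show ν + σ + 1 + (k + σ + 1) = ν + k + 2 * σ + 2 by ring] at h
  rw [EE, ← h, ← integral_const_mul, ← integral_const_mul]
  refine setIntegral_congr_fun measurableSet_Ioo fun t ht => ?_
  have h1 : 0 < 1 - t := by linarith [ht.2]
  simp only [Fm, Nat.sub_self, qp, Polynomial.eval_one, w_rpow ht, add_sub_cancel_right]
  rw [show ν + σ = (ν - k) + (σ + k) by ring, Real.rpow_add h1 (ν - k), add_comm (k : ℝ) σ]
  have : (-1 : ℝ) ^ k * (-1) ^ k = 1 := by rw [← mul_pow]; norm_num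
  linear_combination (fal ν k * ((1 - t) ^ (ν - k) * (1 - t) ^ (σ + k) * (1 + t) ^ (σ + k))) * this

lemma int_Fp {ν σ : ℝ} (hν : 0 < ν) (hσ : 0 ≤ σ) (k : ℕ) :
    ∫ t in Ioo (-1 : ℝ) 1, Fp ν 0 t * (qp (k + σ) k).eval t * (1 - t ^ 2) ^ σ =
      (-1) ^ k * EE ν σ k := by
  rw [ibp (Fp_deriv ν) (Fp_bound hν) hσ k le_rfl]
  have hk : (0 : ℝ) ≤ (k : ℝ) := by positivity
  have h := beta_int (β := ν + σ + 1) (α := k + σ + 1) (by linarith) (by linarith)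
  rw [show (k + σ + 1) + (ν + σ + 1) - 1 = ν + k + 2 * σ + 1 by ring,
    show (k + σ + 1) + (ν + σ + 1) = ν + k + 2 * σ + 2 by ring,
    mul_comm (Real.Gamma (k + σ + 1))] at h
  rw [EE, ← h, ← integral_const_mul, ← integral_const_mul, ← integral_const_mul]
  refine setIntegral_congr_fun measurableSet_Ioo fun t ht => ?_
  have h1 : 0 < 1 + t := by linarith [ht.1]
  simp only [Fp, Nat.sub_self, qp, Polynomial.eval_one, w_rpow ht, add_sub_cancel_right]
  rw [show ν + σ = (ν - k) + (σ + k) by ring, Real.rpow_add h1 (ν - k), add_comm (k : ℝ) σ]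
  ring

lemma Gamma_prod {S : ℝ} (hS : 0 < S) (k : ℕ) :
    Real.Gamma (S + k) = Real.Gamma S * ∏ j ∈ Finset.range k, (S + j) := by
  induction k with
  | zero => simp
  | succ k ih =>
    rw [Finset.prod_range_succ, ← mul_assoc, ← ih, Nat.cast_add, Nat.cast_one, ← add_assoc,
      Real.Gamma_add_one (by positivity)]
    ring

lemma fal_gamma {ν : ℝ} (hν : ∀ n : ℤ, ν ≠ n) (s : ℕ) :
    Real.Gamma (ν + 1) / Real.Gamma (ν + 1 - s) = fal ν s := by
  have hne : ∀ x : ℝ, (∃ n : ℤ, x = ν + n) → Real.Gamma x ≠ 0 := by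
    rintro x ⟨n, rfl⟩
    refine Real.Gamma_ne_zero fun m h => hν (-m - n) ?_
    push_cast; linarith
  rw [div_eq_iff (hne _ ⟨1 - s, by push_cast; ring⟩)]
  induction s with
  | zero => simp [fal]
  | succ s ih =>
    have h0 : ν - s ≠ 0 := fun h => hν s (by push_cast; linarith)
    rw [ih, fal, fal, Finset.prod_range_succ, show ν + 1 - (s : ℝ) = (ν - s) + 1 by ring,
      Real.Gamma_add_one h0, show ν + 1 - ((s + 1 : ℕ) : ℝ) = ν - s by push_cast; ring]
    ring

lemma EE_isBigO {ν σ : ℝ} (hν0 : 0 < ν) (hν : ∀ n : ℤ, ν ≠ n) (hσ : 0 ≤ σ) :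
    (fun k : ℕ => rodA σ k * EE ν σ k) =O[atTop] fun k : ℕ => (k : ℝ) ^ (-2 * ν - 2 * σ - 2) := by
  set S := ν + 2 * σ + 2 with hS
  have hS0 : 0 < S := by linarith
  have hg : Real.Gamma (-ν) ≠ 0 := Real.Gamma_ne_zero fun m h => hν m (by push_cast; linarith)
  have ht := (Real.GammaSeq_tendsto_Gamma S).div (Real.GammaSeq_tendsto_Gamma (-ν)) hg
  have hb := ht.isBigO_one ℝ
  obtain ⟨B, hB⟩ := hb.bound
  have hGS := Real.Gamma_pos_of_pos hS0
  set C := Real.Gamma (σ + 1) * 2 ^ (ν + 2 * σ + 1) * Real.Gamma (ν + σ + 1) / Real.Gamma S with hC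
  refine IsBigO.of_bound (|C| * (4 * B)) ?_
  filter_upwards [hB, eventually_ge_atTop (Nat.ceil (2 * ν)), eventually_ge_atTop (Nat.ceil S),
    eventually_gt_atTop 0] with k hk1 hk2 hk3 hk4
  have hk2 : 2 * ν ≤ k := Nat.ceil_le.1 hk2
  have hk3 : S ≤ k := Nat.ceil_le.1 hk3
  have hk4 : (0 : ℝ) < k := by exact_mod_cast hk4
  have hP : ∏ j ∈ Finset.range k, (S + j) ≠ 0 :=
    Finset.prod_ne_zero_iff.2 fun j _ => by positivity
  have hQ : ∏ j ∈ Finset.range k, (-ν + j) ≠ 0 :=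
    Finset.prod_ne_zero_iff.2 fun j _ h => hν j (by push_cast; linarith)
  have hf : fal ν k = (-1) ^ k * ∏ j ∈ Finset.range k, (-ν + j) := by
    have : ((-1 : ℝ) ^ k) = ∏ j ∈ Finset.range k, (-1 : ℝ) := by simp
    rw [this, ← Finset.prod_mul_distrib, fal]
    exact Finset.prod_congr rfl fun i _ => by ring
  have hgk := (Real.Gamma_pos_of_pos (show 0 < (k : ℝ) + σ + 1 by linarith)).ne'
  have hgs : Real.Gamma (ν + k + 2 * σ + 2) = Real.Gamma S * ∏ j ∈ Finset.range k, (S + j) := by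
    rw [← Gamma_prod hS0]; congr 1; rw [hS]; ring
  have hkν : (k : ℝ) - ν ≠ 0 := by linarith
  have hr : (Real.GammaSeq S k / Real.GammaSeq (-ν) k) * (k : ℝ) ^ (-2 * ν - 2 * σ - 2) *
      ((S + k) / (k - ν)) =
      (∏ j ∈ Finset.range k, (-ν + j)) / ∏ j ∈ Finset.range k, (S + j) := by
    simp only [Real.GammaSeq, Finset.prod_range_succ]
    rw [show -2 * ν - 2 * σ - 2 = (-ν) - S by rw [hS]; ring, Real.rpow_sub hk4]
    have a1 := (Real.rpow_pos_of_pos hk4 S).ne'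
    have a2 := (Real.rpow_pos_of_pos hk4 (-ν)).ne'
    have a3 : (k.factorial : ℝ) ≠ 0 := by positivity
    have a4 : S + k ≠ 0 := by positivity
    have a5 : -ν + k ≠ 0 := by intro h; apply hkν; linarith
    rw [show (k : ℝ) - ν = -ν + k by ring]
    field_simp
  have e : rodA σ k * EE ν σ k = C * ((∏ j ∈ Finset.range k, (-ν + j)) /
      ∏ j ∈ Finset.range k, (S + j)) := by
    rw [rodA, EE, hf, hgs, show ν + k + 2 * σ + 1 = (ν + 2 * σ + 1) + k by ring,
      Real.rpow_add_natCast (by norm_num), hC]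
    have : (-1 / 2 : ℝ) ^ k * (-1) ^ k * 2 ^ k = 1 := by
      rw [← mul_pow, ← mul_pow]; norm_num
    field_simp
    linear_combination this
  rw [e, ← hr, norm_mul, norm_mul, norm_mul, Real.norm_eq_abs C]
  have b1 : ‖(S + k) / (k - ν)‖ ≤ 4 := by
    rw [Real.norm_of_nonneg (div_nonneg (by linarith) (by linarith)), div_le_iff₀ (by linarith)]
    linarith
  simp only [norm_one, mul_one, Pi.div_apply] at hk1
  have hB0 : 0 ≤ B := (norm_nonneg _).trans hk1
  calc |C| * (‖Real.GammaSeq S k / Real.GammaSeq (-ν) k‖ * ‖(k : ℝ) ^ (-2 * ν - 2 * σ - 2)‖ *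
        ‖(S + k) / (k - ν)‖) ≤ |C| * (B * ‖(k : ℝ) ^ (-2 * ν - 2 * σ - 2)‖ * 4) := by gcongr
    _ = _ := by ring

lemma iterD {κ : ℝ → ℝ} (hκ : ContDiffOn ℝ (⊤ : ℕ∞) κ (Set.Ioo (-1 : ℝ) 1)) (s : ℕ) :
    ∀ t ∈ Ioo (-1 : ℝ) 1, HasDerivAt (iteratedDeriv s κ) (iteratedDeriv (s + 1) κ t) t := by
  intro t ht
  have h1 := hκ.differentiableOn_iteratedDerivWithin (m := s)
    (by exact_mod_cast WithTop.coe_lt_top (s : ℕ)) isOpen_Ioo.uniqueDiffOn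
  have h2 : DifferentiableAt ℝ (iteratedDerivWithin s κ (Ioo (-1) 1)) t :=
    (h1 t ht).differentiableAt (isOpen_Ioo.mem_nhds ht)
  have h3 : iteratedDeriv s κ =ᶠ[𝓝 t] iteratedDerivWithin s κ (Ioo (-1) 1) := by
    filter_upwards [isOpen_Ioo.mem_nhds ht] with x hx
    exact (iteratedDerivWithin_of_isOpen isOpen_Ioo hx).symm
  rw [iteratedDeriv_succ]
  exact (h2.congr_of_eventuallyEq h3).hasDerivAt

lemma rpow_bigO {x y : ℝ} (h : y ≤ x) :
    (fun u : ℝ => u ^ x) =O[𝓝[>] (0 : ℝ)] fun u => u ^ y := by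
  refine IsBigO.of_bound 1 ?_
  filter_upwards [Ioo_mem_nhdsGT (show (0 : ℝ) < 1 by norm_num)] with u hu
  rw [Real.norm_of_nonneg (Real.rpow_nonneg hu.1.le _),
    Real.norm_of_nonneg (Real.rpow_nonneg hu.1.le _), one_mul]
  exact Real.rpow_le_rpow_of_exponent_ge hu.1 hu.2.le h

lemma cont_bigO {h : ℝ → ℝ} (hh : ContinuousAt h 0) {e : ℝ} (he : e ≤ 0) :
    h =O[𝓝[>] (0 : ℝ)] fun u : ℝ => u ^ e := by
  have h1 : h =O[𝓝[>] (0 : ℝ)] fun _ => (1 : ℝ) :=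
    (hh.tendsto.mono_left nhdsWithin_le_nhds).isBigO_one ℝ
  have h2 := rpow_bigO he
  simp only [Real.rpow_zero] at h2
  exact h1.trans h2

lemma glob {f : ℝ → ℝ} {e : ℝ} (he : e ≤ 0) (hf : ContinuousOn f (Ioo (-1 : ℝ) 1))
    (h1 : (fun u => f (1 - u)) =O[𝓝[>] (0 : ℝ)] fun u : ℝ => u ^ e)
    (h2 : (fun u => f (-1 + u)) =O[𝓝[>] (0 : ℝ)] fun u : ℝ => u ^ e) :
    ∃ C, 0 ≤ C ∧ ∀ t ∈ Ioo (-1 : ℝ) 1, |f t| ≤ C * (1 - t ^ 2) ^ e := by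
  obtain ⟨C1, hC1⟩ := h1.bound
  obtain ⟨C2, hC2⟩ := h2.bound
  obtain ⟨δ1, hδ1, hs1⟩ := mem_nhdsGT_iff_exists_Ioo_subset.1 hC1
  obtain ⟨δ2, hδ2, hs2⟩ := mem_nhdsGT_iff_exists_Ioo_subset.1 hC2
  simp only [mem_Ioi] at hδ1 hδ2
  obtain ⟨C3, hC3⟩ := (isCompact_Icc (a := -1 + δ2) (b := 1 - δ1)).exists_bound_of_continuousOn
    (f := f) (hf.mono fun t ht => ⟨by linarith [ht.1], by linarith [ht.2]⟩)
  have key : ∀ u w : ℝ, 0 < u → 0 < w → w ≤ 2 * u → u ^ e ≤ 2 ^ (-e) * w ^ e := by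
    intro u w hu hw hwu
    have a1 := Real.rpow_le_rpow_of_nonpos hw hwu he
    rw [Real.mul_rpow (by norm_num) hu.le] at a1
    rw [Real.rpow_neg (by norm_num)]
    have a2 := Real.rpow_pos_of_pos (show (0 : ℝ) < 2 by norm_num) e
    rw [inv_mul_eq_div, le_div_iff₀ a2]
    linarith
  refine ⟨|C1| * 2 ^ (-e) + |C2| * 2 ^ (-e) + |C3|, by positivity, fun t ht => ?_⟩
  have hw := w_pos ht
  have hwe := Real.rpow_pos_of_pos hw e
  have p1 : 0 ≤ |C1| * 2 ^ (-e) * (1 - t ^ 2) ^ e := by positivity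
  have p2 : 0 ≤ |C2| * 2 ^ (-e) * (1 - t ^ 2) ^ e := by positivity
  have p3 : 0 ≤ |C3| * (1 - t ^ 2) ^ e := by positivity
  have hle : ∀ c u x : ℝ, 0 < u → ‖x‖ ≤ c * ‖u ^ e‖ → (1 - t ^ 2) ≤ 2 * u →
      |x| ≤ |c| * 2 ^ (-e) * (1 - t ^ 2) ^ e := by
    intro c u x hu hx hwu
    have hue := Real.rpow_pos_of_pos hu e
    rw [Real.norm_eq_abs, Real.norm_of_nonneg hue.le] at hx
    have := key u _ hu hw hwu
    calc |x| ≤ c * u ^ e := hx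
      _ ≤ |c| * (2 ^ (-e) * (1 - t ^ 2) ^ e) := by
        gcongr
        exact le_abs_self c
      _ = _ := by ring
  rw [add_mul, add_mul]
  by_cases c1 : 1 - δ1 < t
  · have hu : 0 < 1 - t := by linarith [ht.2]
    have := hs1 (show 1 - t ∈ Ioo 0 δ1 from ⟨hu, by linarith⟩)
    simp only [mem_ofPred_eq, sub_sub_cancel] at this
    have := hle _ _ _ hu this (by nlinarith [sq_nonneg (1 - t)])
    linarith
  by_cases c2 : t < -1 + δ2
  · have hu : 0 < 1 + t := by linarith [ht.1]
    have := hs2 (show 1 + t ∈ Ioo 0 δ2 from ⟨hu, by linarith⟩)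
    simp only [mem_ofPred_eq, neg_add_cancel_left] at this
    have := hle _ _ _ hu this (by nlinarith [sq_nonneg (1 + t)])
    linarith
  · have a := hC3 t ⟨by linarith, by linarith⟩
    rw [Real.norm_eq_abs] at a
    have b : 1 ≤ (1 - t ^ 2) ^ e := Real.one_le_rpow_of_pos_of_le_one_of_nonpos hw w_le he
    have : |C3| * 1 ≤ |C3| * (1 - t ^ 2) ^ e := by gcongr
    linarith [le_abs_self C3]

lemma rem_bound (d m : ℕ) (hd : 3 ≤ d) {σ : ℝ} (hσ : σ = ((d : ℝ) - 3) / 2)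
    {G : ℕ → ℝ → ℝ} (hG : ∀ s, ∀ t ∈ Ioo (-1 : ℝ) 1, HasDerivAt (G s) (G (s + 1) t) t)
    (hGb : ∀ s, ∃ C, ∀ t ∈ Ioo (-1 : ℝ) 1, |G s t| * (1 - t ^ 2) ^ s ≤ C) {e C : ℝ}
    (hm : ∀ t ∈ Ioo (-1 : ℝ) 1, |G m t| ≤ C * (1 - t ^ 2) ^ e)
    (he : -1 < 2 * e + (σ + m)) :
    (fun k : ℕ => rodA σ k *
      ∫ t in Ioo (-1 : ℝ) 1, G 0 t * (qp (k + σ) k).eval t * (1 - t ^ 2) ^ σ)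
      =O[atTop] fun k : ℕ => (k : ℝ) ^ (-((m : ℝ) + d / 2 - 1)) := by
  have hd' : (3 : ℝ) ≤ d := by exact_mod_cast hd
  have hσ0 : 0 ≤ σ := by rw [hσ]; linarith
  have hm0 : (0 : ℝ) ≤ m := by positivity
  set p : ℝ := (m : ℝ) + d / 2 - 1 with hp
  have hp0 : 0 ≤ p := by rw [hp]; linarith
  have hcG : ContinuousOn (G m) (Ioo (-1 : ℝ) 1) :=
    fun t ht => (hG m t ht).continuousAt.continuousWithinAt
  have hi1 : IntegrableOn (fun t => G m t ^ 2 * (1 - t ^ 2) ^ (σ + m)) (Ioo (-1 : ℝ) 1) := by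
    refine Integrable.mono' ((w_integrable he).const_mul (C ^ 2)) ?_ ?_
    · exact ((hcG.pow 2).mul (cont_w _)).aestronglyMeasurable measurableSet_Ioo
    · refine (ae_restrict_iff' measurableSet_Ioo).2 (Eventually.of_forall fun t ht => ?_)
      have hw := w_pos ht
      have h1 := hm t ht
      have h2 := Real.rpow_nonneg hw.le (σ + m)
      rw [Real.norm_of_nonneg (by positivity), Real.rpow_add hw (2 * e), two_mul,
        Real.rpow_add hw e, ← sq_abs (G m t)]
      calc |G m t| ^ 2 * (1 - t ^ 2) ^ (σ + m)
          ≤ (C * (1 - t ^ 2) ^ e) ^ 2 * (1 - t ^ 2) ^ (σ + m) := by gcongr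
        _ = _ := by ring
  set I := ∫ t in Ioo (-1 : ℝ) 1, G m t ^ 2 * (1 - t ^ 2) ^ (σ + m) with hI
  have hI0 : 0 ≤ I := by
    refine setIntegral_nonneg measurableSet_Ioo fun t ht => ?_
    have := Real.rpow_nonneg (w_pos ht).le (σ + m)
    positivity
  set D := Real.Gamma (σ + 1) ^ 2 * 2 ^ (2 * σ + 1) with hD
  have hD0 : 0 ≤ D := by positivity
  refine IsBigO.of_bound ((I + D) / 2 * (m + 1) ^ p) ?_
  filter_upwards [eventually_ge_atTop m, eventually_gt_atTop 0] with k hk hk0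
  obtain ⟨N, rfl⟩ : ∃ N, k = N + m := ⟨k - m, by omega⟩
  have hk0' : (0 : ℝ) < ((N + m : ℕ) : ℝ) := by exact_mod_cast hk0
  rw [ibp hG hGb hσ0 m hk, show N + m - m = N by omega]
  set q := qp (((N + m : ℕ) : ℝ) + σ) N with hq
  set A := rodA σ (N + m) with hA
  have hi2 : IntegrableOn (fun t => q.eval t ^ 2 * (1 - t ^ 2) ^ (σ + m)) (Ioo (-1 : ℝ) 1) := by
    obtain ⟨K, -, hK⟩ := poly_bdd q
    have := integrable_fq (f := fun t => q.eval t) (s := 0) q.continuous.continuousOn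
      (C := K) (fun t ht => by simpa using hK t ht) q (b := σ + m) (by positivity)
    simp only [Nat.cast_zero, add_zero] at this
    refine this.congr (Eventually.of_forall fun t => ?_)
    simp only; ring
  have hN1 : (0 : ℝ) < (N : ℝ) + 1 := by positivity
  set L := ((N : ℝ) + 1) ^ p with hL
  have hL0 : 0 < L := Real.rpow_pos_of_pos hN1 p
  have hM := M_bound d m N hd hσ
  rw [← hq, ← hA, ← hD] at hM
  have hLL : ((N : ℝ) + 1) ^ (2 * m + d - 2) = L * L := by
    rw [hL, ← Real.rpow_add hN1, ← Real.rpow_natCast]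
    congr 1
    rw [Nat.cast_sub (by omega), hp]; push_cast; ring
  rw [hLL] at hM
  set M := ∫ t in Ioo (-1 : ℝ) 1, q.eval t ^ 2 * (1 - t ^ 2) ^ (σ + m) with hMdef
  have hInt := (hi1.const_mul (L⁻¹ / 2)).add (hi2.const_mul (A ^ 2 * (L / 2)))
  have hb : ‖∫ t in Ioo (-1 : ℝ) 1, A * (G m t * q.eval t * (1 - t ^ 2) ^ (σ + m))‖ ≤
      ∫ t in Ioo (-1 : ℝ) 1, (L⁻¹ / 2 * (G m t ^ 2 * (1 - t ^ 2) ^ (σ + m)) +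
        A ^ 2 * (L / 2) * (q.eval t ^ 2 * (1 - t ^ 2) ^ (σ + m))) := by
    refine norm_integral_le_of_norm_le hInt ?_
    refine (ae_restrict_iff' measurableSet_Ioo).2 (Eventually.of_forall fun t ht => ?_)
    have h2 := Real.rpow_nonneg (w_pos ht).le (σ + m)
    have h3 : |A * (G m t * q.eval t)| ≤ L⁻¹ / 2 * G m t ^ 2 + A ^ 2 * (L / 2) * q.eval t ^ 2 := by
      rw [abs_le]
      have hh : ∀ x y : ℝ, L⁻¹ / 2 * x ^ 2 + L / 2 * y ^ 2 - x * y = L⁻¹ / 2 * (x - L * y) ^ 2 := by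
        intro x y; field_simp; ring
      have h4 := hh (G m t) (A * q.eval t)
      have h5 := hh (G m t) (-(A * q.eval t))
      have h6 : 0 ≤ L⁻¹ / 2 * (G m t - L * (A * q.eval t)) ^ 2 := by positivity
      have h7 : 0 ≤ L⁻¹ / 2 * (G m t - L * (-(A * q.eval t))) ^ 2 := by positivity
      constructor <;> nlinarith
    calc ‖A * (G m t * q.eval t * (1 - t ^ 2) ^ (σ + m))‖
        = |A * (G m t * q.eval t)| * (1 - t ^ 2) ^ (σ + m) := by
          rw [Real.norm_eq_abs, ← mul_assoc, abs_mul _ ((1 - t ^ 2) ^ (σ + (m : ℝ))), abs_of_nonneg h2]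
      _ ≤ (L⁻¹ / 2 * G m t ^ 2 + A ^ 2 * (L / 2) * q.eval t ^ 2) * (1 - t ^ 2) ^ (σ + m) := by gcongr
      _ = _ := by ring
  rw [integral_add (hi1.const_mul _) (hi2.const_mul _), integral_const_mul, integral_const_mul,
    integral_const_mul, ← hI, ← hMdef] at hb
  have hb2 : ‖A * ((-1) ^ m * ∫ t in Ioo (-1 : ℝ) 1, G m t * q.eval t * (1 - t ^ 2) ^ (σ + m))‖ ≤
      (I + D) / 2 * L⁻¹ := by
    have e0 : ‖A * ((-1) ^ m * ∫ t in Ioo (-1 : ℝ) 1, G m t * q.eval t * (1 - t ^ 2) ^ (σ + m))‖ =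
      ‖A * ∫ t in Ioo (-1 : ℝ) 1, G m t * q.eval t * (1 - t ^ 2) ^ (σ + m)‖ := by
      simp [norm_mul]
    rw [e0]
    refine hb.trans ?_
    have : A ^ 2 * (L / 2) * M ≤ D / 2 * L⁻¹ := by
      calc A ^ 2 * (L / 2) * M = (L / 2) * (A ^ 2 * M) := by ring
        _ ≤ (L / 2) * (D * (1 / (L * L))) := by gcongr
        _ = _ := by field_simp
    linarith
  refine hb2.trans ?_
  rw [mul_assoc]
  have : L⁻¹ ≤ (m + 1) ^ p * ‖((N + m : ℕ) : ℝ) ^ (-p)‖ := by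
    rw [Real.norm_of_nonneg (Real.rpow_nonneg hk0'.le _), Real.rpow_neg hk0'.le, ← div_eq_mul_inv,
      inv_eq_one_div, div_le_div_iff₀ hL0 (Real.rpow_pos_of_pos hk0' p), one_mul, hL,
      ← Real.mul_rpow (by positivity) hN1.le]
    refine Real.rpow_le_rpow hk0'.le ?_ hp0
    push_cast
    have : (0 : ℝ) ≤ N := by positivity
    nlinarith
  gcongr

lemma nat_rpow_littleO {a b : ℝ} (h : a < b) :
    (fun k : ℕ => (k : ℝ) ^ a) =o[atTop] fun k : ℕ => (k : ℝ) ^ b := by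
  refine (isLittleO_iff_tendsto' ?_).2 ?_
  · filter_upwards [eventually_gt_atTop 0] with k hk h0
    have : (0 : ℝ) < k := by exact_mod_cast hk
    exact absurd h0 (Real.rpow_pos_of_pos this b).ne'
  · have := (tendsto_rpow_neg_atTop (show 0 < b - a by linarith)).comp
      (tendsto_natCast_atTop_atTop (R := ℝ))
    refine this.congr' ?_
    filter_upwards [eventually_gt_atTop 0] with k hk
    have hk : (0 : ℝ) < k := by exact_mod_cast hk
    simp only [Function.comp]
    rw [← Real.rpow_sub hk]; congr 1; ring

/-- Remainder after removing the endpoint powers. -/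
noncomputable def remG (κ : ℝ → ℝ) (r : ℕ) (ν c1 cm1 : ℕ → ℝ) (s : ℕ) (t : ℝ) : ℝ :=
  iteratedDeriv s κ t - ∑ j ∈ Finset.range r, c1 j * Fm (ν j) s t
    - ∑ j ∈ Finset.range r, cm1 j * Fp (ν j) s t

lemma remG_deriv {κ : ℝ → ℝ} (hκ : ContDiffOn ℝ (⊤ : ℕ∞) κ (Set.Ioo (-1 : ℝ) 1))
    (r : ℕ) (ν c1 cm1 : ℕ → ℝ) (s : ℕ) : ∀ t ∈ Ioo (-1 : ℝ) 1,
    HasDerivAt (remG κ r ν c1 cm1 s) (remG κ r ν c1 cm1 (s + 1) t) t := by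
  intro t ht
  refine ((iterD hκ s t ht).sub ?_).sub ?_
  · exact HasDerivAt.fun_sum fun j _ => (Fm_deriv (ν j) s t ht).const_mul (c1 j)
  · exact HasDerivAt.fun_sum fun j _ => (Fp_deriv (ν j) s t ht).const_mul (cm1 j)

lemma remG_bound {κ : ℝ → ℝ} (hκ : ContDiffOn ℝ (⊤ : ℕ∞) κ (Set.Ioo (-1 : ℝ) 1))
    {r : ℕ} {ν c1 cm1 : ℕ → ℝ} {ν₁ ε : ℝ} (hε : 0 < ε)
    (hν : ∀ j, j < r → 0 < ν j ∧ ∀ n : ℤ, ν j ≠ (n : ℝ))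
    (hexp1 : ∀ s : ℕ, ∃ p : Polynomial ℝ,
      (fun t : ℝ => iteratedDeriv s κ (1 - t) -
          (p.eval t + (-1 : ℝ) ^ s * ∑ j ∈ Finset.range r,
            c1 j * (Real.Gamma (ν j + 1) / Real.Gamma (ν j + 1 - s)) * t ^ (ν j - s)))
        =O[𝓝[>] (0 : ℝ)] fun t => t ^ (ν₁ + 1 + ε - s))
    (hexpm1 : ∀ s : ℕ, ∃ p : Polynomial ℝ,
      (fun t : ℝ => iteratedDeriv s κ (-1 + t) -
          (p.eval t + ∑ j ∈ Finset.range r,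
            cm1 j * (Real.Gamma (ν j + 1) / Real.Gamma (ν j + 1 - s)) * t ^ (ν j - s)))
        =O[𝓝[>] (0 : ℝ)] fun t => t ^ (ν₁ + 1 + ε - s)) (s : ℕ) {e : ℝ} (he0 : e ≤ 0)
    (he : e ≤ ν₁ + 1 - s) :
    ∃ C, 0 ≤ C ∧ ∀ t ∈ Ioo (-1 : ℝ) 1, |remG κ r ν c1 cm1 s t| ≤ C * (1 - t ^ 2) ^ e := by
  have hc2 : ∀ x : ℝ, ContinuousAt (fun u : ℝ => (2 - u) ^ x) 0 := by
    intro x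
    have h : ContinuousAt (fun u : ℝ => 2 - u) 0 := by fun_prop
    exact h.rpow_const (Or.inl (by norm_num))
  refine glob he0
    (fun t ht => (remG_deriv hκ r ν c1 cm1 s t ht).continuousAt.continuousWithinAt) ?_ ?_
  · obtain ⟨p, hp⟩ := hexp1 s
    have h1 := hp.trans (rpow_bigO (show e ≤ ν₁ + 1 + ε - s by linarith))
    have h2 : (fun u : ℝ => p.eval u) =O[𝓝[>] (0 : ℝ)] fun u : ℝ => u ^ e :=
      cont_bigO p.continuous.continuousAt he0
    have h3 : (fun u : ℝ => ∑ j ∈ Finset.range r, cm1 j * Fp (ν j) s (1 - u)) =O[𝓝[>] (0 : ℝ)]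
        fun u : ℝ => u ^ e := by
      refine IsBigO.fun_sum fun j _ => ?_
      refine IsBigO.const_mul_left (IsBigO.const_mul_left ?_ _) _
      refine (cont_bigO (hc2 (ν j - s)) he0).congr_left fun u => ?_
      congr 1; ring
    refine ((h1.add h2).sub h3).congr_left fun u => ?_
    have : ∑ j ∈ Finset.range r, c1 j * Fm (ν j) s (1 - u) = (-1 : ℝ) ^ s * ∑ j ∈ Finset.range r,
            c1 j * (Real.Gamma (ν j + 1) / Real.Gamma (ν j + 1 - s)) * u ^ (ν j - s) := by
      rw [Finset.mul_sum]
      refine Finset.sum_congr rfl fun j hj => ?_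
      rw [fal_gamma (hν j (Finset.mem_range.1 hj)).2, Fm, sub_sub_cancel]
      ring
    rw [remG, this]; ring
  · obtain ⟨p, hp⟩ := hexpm1 s
    have h1 := hp.trans (rpow_bigO (show e ≤ ν₁ + 1 + ε - s by linarith))
    have h2 : (fun u : ℝ => p.eval u) =O[𝓝[>] (0 : ℝ)] fun u : ℝ => u ^ e :=
      cont_bigO p.continuous.continuousAt he0
    have h3 : (fun u : ℝ => ∑ j ∈ Finset.range r, c1 j * Fm (ν j) s (-1 + u)) =O[𝓝[>] (0 : ℝ)]
        fun u : ℝ => u ^ e := by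
      refine IsBigO.fun_sum fun j _ => ?_
      refine IsBigO.const_mul_left (IsBigO.const_mul_left (IsBigO.const_mul_left ?_ _) _) _
      refine (cont_bigO (hc2 (ν j - s)) he0).congr_left fun u => ?_
      congr 1; ring
    refine ((h1.add h2).sub h3).congr_left fun u => ?_
    have : ∑ j ∈ Finset.range r, cm1 j * Fp (ν j) s (-1 + u) = ∑ j ∈ Finset.range r,
            cm1 j * (Real.Gamma (ν j + 1) / Real.Gamma (ν j + 1 - s)) * u ^ (ν j - s) := by
      refine Finset.sum_congr rfl fun j hj => ?_
      rw [fal_gamma (hν j (Finset.mem_range.1 hj)).2, Fp, show 1 + (-1 + u) = u by ring]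
      ring
    rw [remG, this]; ring

lemma main_aux (d : ℕ) (hd : 3 ≤ d)
    (κ : ℝ → ℝ) (r : ℕ) (ν c1 cm1 : ℕ → ℝ) (ν₁ ε : ℝ)
    (hκ : ContDiffOn ℝ (⊤ : ℕ∞) κ (Set.Ioo (-1 : ℝ) 1))
    (hν0 : ν 0 = ν₁)
    (hν₁pos : 0 < ν₁)
    (hν : ∀ j, j < r → 0 < ν j ∧ ∀ n : ℤ, ν j ≠ (n : ℝ))
    (hνmono : ∀ i j, i < j → j < r → ν i < ν j)
    (hε : 0 < ε)
    (hexp1 : ∀ s : ℕ, ∃ p : Polynomial ℝ,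
      (fun t : ℝ => iteratedDeriv s κ (1 - t) -
          (p.eval t + (-1 : ℝ) ^ s * ∑ j ∈ Finset.range r,
            c1 j * (Real.Gamma (ν j + 1) / Real.Gamma (ν j + 1 - s)) * t ^ (ν j - s)))
        =O[𝓝[>] (0 : ℝ)] fun t => t ^ (ν₁ + 1 + ε - s))
    (hexpm1 : ∀ s : ℕ, ∃ p : Polynomial ℝ,
      (fun t : ℝ => iteratedDeriv s κ (-1 + t) -
          (p.eval t + ∑ j ∈ Finset.range r,
            cm1 j * (Real.Gamma (ν j + 1) / Real.Gamma (ν j + 1 - s)) * t ^ (ν j - s)))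
        =O[𝓝[>] (0 : ℝ)] fun t => t ^ (ν₁ + 1 + ε - s))
    (l : Filter ℕ) (hl : l ≤ atTop) (h0 : ∀ᶠ k in l, c1 0 + (-1) ^ k * cm1 0 = 0) :
    (fun k : ℕ => legendreCoeff d k κ) =o[l] fun k => (k : ℝ) ^ (-(d : ℝ) - 2 * ν₁ + 1) := by
  have hd' : (3 : ℝ) ≤ d := by exact_mod_cast hd
  obtain ⟨σ, hσ⟩ : ∃ σ : ℝ, σ = ((d : ℝ) - 3) / 2 := ⟨_, rfl⟩
  have hσ0 : 0 ≤ σ := by rw [hσ]; linarith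
  have hGd := remG_deriv hκ r ν c1 cm1
  have hGb : ∀ s, ∃ C, ∀ t ∈ Ioo (-1 : ℝ) 1, |remG κ r ν c1 cm1 s t| * (1 - t ^ 2) ^ s ≤ C := by
    intro s
    obtain ⟨C, hC0, hC⟩ := remG_bound hκ hε hν hexp1 hexpm1 s (e := -s) (by simp) (by linarith)
    refine ⟨C, fun t ht => ?_⟩
    have hw := w_pos ht
    have := hC t ht
    rw [Real.rpow_neg hw.le, Real.rpow_natCast, ← div_eq_mul_inv, le_div_iff₀ (by positivity)] at this
    exact this
  -- choice of the number of integrations by parts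
  obtain ⟨m, hm1, hm2⟩ : ∃ m : ℕ, (d : ℝ) / 2 + 2 * ν₁ < m ∧ (m : ℝ) ≤ d / 2 + 2 * ν₁ + 1 := by
    refine ⟨⌊(d : ℝ) / 2 + 2 * ν₁⌋₊ + 1, ?_, ?_⟩
    · push_cast; exact Nat.lt_floor_add_one _
    · push_cast; linarith [Nat.floor_le (show 0 ≤ (d : ℝ) / 2 + 2 * ν₁ by positivity)]
  obtain ⟨C, -, hC⟩ := remG_bound hκ hε hν hexp1 hexpm1 m (e := ν₁ + 1 - m) (by linarith) le_rfl
  have hrem := rem_bound d m hd hσ hGd hGb hC (by linarith)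
  have hrem' : (fun k : ℕ => rodA σ k *
      ∫ t in Ioo (-1 : ℝ) 1, remG κ r ν c1 cm1 0 t * (qp (k + σ) k).eval t * (1 - t ^ 2) ^ σ)
      =o[l] fun k => (k : ℝ) ^ (-(d : ℝ) - 2 * ν₁ + 1) :=
    (hrem.trans_isLittleO (nat_rpow_littleO (by linarith))).mono hl
  have hsum : (fun k : ℕ => ∑ j ∈ Finset.range r, (c1 j + (-1) ^ k * cm1 j) * (rodA σ k * EE (ν j) σ k))
      =o[l] fun k => (k : ℝ) ^ (-(d : ℝ) - 2 * ν₁ + 1) := by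
    refine IsLittleO.fun_sum fun j hj => ?_
    have hj := Finset.mem_range.1 hj
    rcases Nat.eq_zero_or_pos j with rfl | hj0
    · refine (isLittleO_zero _ _).congr' ?_ EventuallyEq.rfl
      filter_upwards [h0] with k hk
      rw [hk, zero_mul]
    · have h1 := EE_isBigO (hν j hj).1 (hν j hj).2 hσ0
      have h2 := hνmono 0 j hj0 hj
      rw [hν0] at h2
      have h3 : (fun k : ℕ => rodA σ k * EE (ν j) σ k) =o[l]
          fun k => (k : ℝ) ^ (-(d : ℝ) - 2 * ν₁ + 1) :=
        (h1.trans_isLittleO (nat_rpow_littleO (by rw [hσ]; linarith))).mono hl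
      have h4 : (fun k : ℕ => c1 j + (-1) ^ k * cm1 j) =O[l] fun _ => (1 : ℝ) := by
        refine IsBigO.of_bound (|c1 j| + |cm1 j|) (Eventually.of_forall fun k => ?_)
        rw [norm_one, mul_one, Real.norm_eq_abs]
        refine (abs_add_le _ _).trans ?_
        rw [abs_mul, abs_pow, abs_neg, abs_one, one_pow, one_mul]
      simpa using h4.mul_isLittleO h3
  refine ((hrem'.add hsum).const_mul_left (sphereSurface (d - 1) / sphereSurface d)).congr_left
    fun k => ?_
  rw [legendreCoeff_eq d k κ σ hσ]
  congr 1
  have intOf : ∀ f : ℝ → ℝ, ContinuousOn f (Ioo (-1 : ℝ) 1) →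
      (∃ C, ∀ t ∈ Ioo (-1 : ℝ) 1, |f t| * (1 - t ^ 2) ^ 0 ≤ C) →
      IntegrableOn (fun t => f t * (qp (k + σ) k).eval t * (1 - t ^ 2) ^ σ) (Ioo (-1 : ℝ) 1) := by
    rintro f hf ⟨C, hC⟩
    have := integrable_fq hf hC (qp (k + σ) k) hσ0
    simpa using this
  have i0 := intOf _ (fun t ht => (hGd 0 t ht).continuousAt.continuousWithinAt) (hGb 0)
  have i1 : ∀ j ∈ Finset.range r, IntegrableOn (fun t => c1 j *
      (Fm (ν j) 0 t * (qp (k + σ) k).eval t * (1 - t ^ 2) ^ σ)) (Ioo (-1 : ℝ) 1) := fun j hj =>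
    (intOf _ (fun t ht => (Fm_deriv (ν j) 0 t ht).continuousAt.continuousWithinAt)
      (Fm_bound (hν j (Finset.mem_range.1 hj)).1 0)).const_mul _
  have i2 : ∀ j ∈ Finset.range r, IntegrableOn (fun t => cm1 j *
      (Fp (ν j) 0 t * (qp (k + σ) k).eval t * (1 - t ^ 2) ^ σ)) (Ioo (-1 : ℝ) 1) := fun j hj =>
    (intOf _ (fun t ht => (Fp_deriv (ν j) 0 t ht).continuousAt.continuousWithinAt)
      (Fp_bound (hν j (Finset.mem_range.1 hj)).1 0)).const_mul _
  have split : ∫ t in Ioo (-1 : ℝ) 1, κ t * (qp (k + σ) k).eval t * (1 - t ^ 2) ^ σ =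
      (∫ t in Ioo (-1 : ℝ) 1, remG κ r ν c1 cm1 0 t * (qp (k + σ) k).eval t * (1 - t ^ 2) ^ σ)
      + ∑ j ∈ Finset.range r, c1 j * EE (ν j) σ k
      + ∑ j ∈ Finset.range r, cm1 j * ((-1) ^ k * EE (ν j) σ k) := by
    have s1 : ∑ j ∈ Finset.range r, c1 j * EE (ν j) σ k = ∫ t in Ioo (-1 : ℝ) 1,
        ∑ j ∈ Finset.range r, c1 j * (Fm (ν j) 0 t * (qp (k + σ) k).eval t * (1 - t ^ 2) ^ σ) := by
      rw [integral_finsetSum _ i1]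
      refine Finset.sum_congr rfl fun j hj => ?_
      rw [integral_const_mul, int_Fm (hν j (Finset.mem_range.1 hj)).1 hσ0]
    have s2 : ∑ j ∈ Finset.range r, cm1 j * ((-1) ^ k * EE (ν j) σ k) = ∫ t in Ioo (-1 : ℝ) 1,
        ∑ j ∈ Finset.range r, cm1 j * (Fp (ν j) 0 t * (qp (k + σ) k).eval t * (1 - t ^ 2) ^ σ) := by
      rw [integral_finsetSum _ i2]
      refine Finset.sum_congr rfl fun j hj => ?_
      rw [integral_const_mul, int_Fp (hν j (Finset.mem_range.1 hj)).1 hσ0]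
    have j1 := integrable_finsetSum _ i1
    have j2 := integrable_finsetSum _ i2
    have e1 := integral_add i0 j1
    have e2 := integral_add (i0.add j1) j2
    simp only [Pi.add_apply] at e1 e2
    rw [s1, s2, ← e1, ← e2]
    congr 1
    ext t
    simp only [remG, iteratedDeriv_zero, ← mul_assoc, ← Finset.sum_mul]
    ring
  rw [split, mul_add, mul_add, Finset.mul_sum, Finset.mul_sum, add_assoc, ← Finset.sum_add_distrib]
  congr 1
  exact Finset.sum_congr rfl fun j _ => by ring

/-- Main theorem, degenerate cases: when the leading endpoint coefficients cancel, the Legendre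
coefficients `μ_k(κ)` are `o(k^{-d-2ν₁+1})` along the corresponding parity. -/
theorem main_decay_degenerate (d : ℕ) (hd : 3 ≤ d)
    (κ : ℝ → ℝ) (r : ℕ) (ν c1 cm1 : ℕ → ℝ) (ν₁ ε : ℝ)
    (hr : 1 ≤ r)
    (hκ : ContDiffOn ℝ (⊤ : ℕ∞) κ (Set.Ioo (-1 : ℝ) 1))
    (hν0 : ν 0 = ν₁)
    (hν₁pos : 0 < ν₁) (hν₁nonint : ∀ n : ℤ, ν₁ ≠ (n : ℝ))
    (hν : ∀ j, j < r → 0 < ν j ∧ ∀ n : ℤ, ν j ≠ (n : ℝ))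
    (hνmono : ∀ i j, i < j → j < r → ν i < ν j)
    (hε : 0 < ε) (hε' : 2 ≤ r → ε < ν 1 - ν₁)
    (hexp1 : ∀ s : ℕ, ∃ p : Polynomial ℝ,
      (fun t : ℝ => iteratedDeriv s κ (1 - t) -
          (p.eval t + (-1 : ℝ) ^ s * ∑ j ∈ Finset.range r,
            c1 j * (Real.Gamma (ν j + 1) / Real.Gamma (ν j + 1 - s)) * t ^ (ν j - s)))
        =O[𝓝[>] (0 : ℝ)] fun t => t ^ (ν₁ + 1 + ε - s))
    (hexpm1 : ∀ s : ℕ, ∃ p : Polynomial ℝ,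
      (fun t : ℝ => iteratedDeriv s κ (-1 + t) -
          (p.eval t + ∑ j ∈ Finset.range r,
            cm1 j * (Real.Gamma (ν j + 1) / Real.Gamma (ν j + 1 - s)) * t ^ (ν j - s)))
        =O[𝓝[>] (0 : ℝ)] fun t => t ^ (ν₁ + 1 + ε - s)) :
    (c1 0 = -cm1 0 →
      (fun k : ℕ => legendreCoeff d k κ)
        =o[atTop ⊓ 𝓟 {k | Even k}] fun k => (k : ℝ) ^ (-(d : ℝ) - 2 * ν₁ + 1)) ∧
    (c1 0 = cm1 0 →
      (fun k : ℕ => legendreCoeff d k κ)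
        =o[atTop ⊓ 𝓟 {k | Odd k}] fun k => (k : ℝ) ^ (-(d : ℝ) - 2 * ν₁ + 1)) := by
  have aux := main_aux d hd κ r ν c1 cm1 ν₁ ε hκ hν0 hν₁pos hν hνmono hε hexp1 hexpm1
  refine ⟨fun h => aux _ inf_le_left ?_, fun h => aux _ inf_le_left ?_⟩
  · filter_upwards [mem_inf_of_right (mem_principal_self _)] with k hk
    have hk : Even k := hk
    rw [hk.neg_one_pow, h]; ring
  · filter_upwards [mem_inf_of_right (mem_principal_self _)] with k hk
    have hk : Odd k := hk
    rw [hk.neg_one_pow, h]; ring
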